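/- Let ω be a weight on ℝ₊ and 1 < p < ∞. Then D_0^{1,p}(ℝ₊,ω) = R^0_{p,ω}(0) if and only if ω ∈ B_p(0) and ω ∉ B_p(∞); and D_0^{1,p}(ℝ₊,ω) = D^{1,p}(ℝ₊,ω) if and only if ω ∉ B_p(0) and ω ∉ B_p(∞). -/

import Mathlib

open MeasureTheory Set Filter Topology
open scoped NNReal ENNReal

noncomputable section

/-- A weight on `ℝ₊ = (0,∞)`: continuous and positive there. -/
def IsWeight (ω : ℝ → ℝ) : Prop :=
  ContinuousOn ω (Set.Ioi 0) ∧ ∀ t : ℝ, 0 < t → 0 < ω t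

/-- Membership of the pair `(u, u')` in the weighted Dirichlet space
`D^{1,p}(ℝ₊, ω)`: `u'` is locally integrable on `(0,∞)`, `u` is locally
absolutely continuous with derivative `u'`, and `∫_0^∞ |u'|^p ω < ∞`. -/
def MemD (p : ℝ) (ω u u' : ℝ → ℝ) : Prop :=
  (∀ a b : ℝ, 0 < a → a < b → IntegrableOn u' (Set.Ioc a b)) ∧
  (∀ a b : ℝ, 0 < a → a < b → u b - u a = ∫ τ in a..b, u' τ) ∧
  IntegrableOn (fun t => |u' t| ^ p * ω t) (Set.Ioi 0)

/-- `‖u'‖_{L^p(ℝ₊, ω)} = (∫_0^∞ |u'(t)|^p ω(t) dt)^{1/p}`. -/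
def dNorm (p : ℝ) (ω u' : ℝ → ℝ) : ℝ :=
  (∫ t in Set.Ioi (0:ℝ), |u' t| ^ p * ω t) ^ (1 / p)

/-- The norm `‖u‖^{(a)} = |u(a)| + ‖u'‖_{L^p(ℝ₊, ω)}`. -/
def aNorm (p : ℝ) (ω : ℝ → ℝ) (a : ℝ) (u u' : ℝ → ℝ) : ℝ :=
  |u a| + dNorm p ω u'

/-- `ω ∈ B_p(0)`: `∫_0^1 ω(t)^{-1/(p-1)} dt < ∞`. -/
def Bp0 (p : ℝ) (ω : ℝ → ℝ) : Prop :=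
  IntegrableOn (fun t => ω t ^ (-1 / (p - 1))) (Set.Ioc (0:ℝ) 1)

/-- `ω ∈ B_p(∞)`: `∫_1^∞ ω(t)^{-1/(p-1)} dt < ∞`. -/
def BpInf (p : ℝ) (ω : ℝ → ℝ) : Prop :=
  IntegrableOn (fun t => ω t ^ (-1 / (p - 1))) (Set.Ioi (1:ℝ))

/-- `Ω^0_ω(t) = (∫_0^t ω(τ)^{-1/(p-1)} dτ)^{1-1/p}`. -/
def Omega0 (p : ℝ) (ω : ℝ → ℝ) (t : ℝ) : ℝ :=
  (∫ τ in Set.Ioc (0:ℝ) t, ω τ ^ (-1 / (p - 1))) ^ (1 - 1 / p)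

/-- `Ω^∞_ω(t) = (∫_t^∞ ω(τ)^{-1/(p-1)} dτ)^{1-1/p}`. -/
def OmegaInf (p : ℝ) (ω : ℝ → ℝ) (t : ℝ) : ℝ :=
  (∫ τ in Set.Ioi t, ω τ ^ (-1 / (p - 1))) ^ (1 - 1 / p)

/-- `R^0_{p,ω}(c)`: elements of `D^{1,p}(ℝ₊,ω)` with
`u(t) = c + ∫_0^t u'(τ) dτ` for every `t > 0`. -/
def MemR0 (p : ℝ) (ω : ℝ → ℝ) (c : ℝ) (u u' : ℝ → ℝ) : Prop :=
  MemD p ω u u' ∧ ∀ t : ℝ, 0 < t →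
    IntegrableOn u' (Set.Ioc 0 t) ∧ u t = c + ∫ τ in Set.Ioc (0:ℝ) t, u' τ

/-- `R^∞_{p,ω}(c)`: elements of `D^{1,p}(ℝ₊,ω)` with
`u(t) = c - ∫_t^∞ u'(τ) dτ` for every `t > 0`. -/
def MemRInf (p : ℝ) (ω : ℝ → ℝ) (c : ℝ) (u u' : ℝ → ℝ) : Prop :=
  MemD p ω u u' ∧ ∀ t : ℝ, 0 < t →
    IntegrableOn u' (Set.Ioi t) ∧ u t = c - ∫ τ in Set.Ioi t, u' τ

/-- `D_0^{1,p}(ℝ₊,ω)`: elements of `D^{1,p}(ℝ₊,ω)` approximable by smooth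
compactly supported functions on `(0,∞)`, with derivatives converging in
`L^p(ℝ₊,ω)` and locally uniform convergence on compact subsets of `(0,∞)`. -/
def MemD0 (p : ℝ) (ω u u' : ℝ → ℝ) : Prop :=
  MemD p ω u u' ∧
  ∃ φ : ℕ → ℝ → ℝ,
    (∀ n, ContDiff ℝ (⊤ : ℕ∞) (φ n) ∧ HasCompactSupport (φ n) ∧ tsupport (φ n) ⊆ Set.Ioi 0) ∧
    Tendsto (fun n => ∫ t in Set.Ioi (0:ℝ), |deriv (φ n) t - u' t| ^ p * ω t)
      atTop (𝓝 0) ∧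
    (∀ K : Set ℝ, K ⊆ Set.Ioi 0 → IsCompact K →
      TendstoUniformlyOn (fun n => φ n) u atTop K)

/-- The function `f ω^{1/p}`, whose `L^p(ℝ₊)` norm is the `L^p(ℝ₊, ω)` norm of `f`. -/
def weightedFun (p : ℝ) (ω f : ℝ → ℝ) : ℝ → ℝ := fun t => f t * ω t ^ (1 / p)

/-- The norm of `L^p(ℝ₊, ω)`, with values in `[0, ∞]`. -/
def wnorm (p : ℝ) (ω f : ℝ → ℝ) : ℝ≥0∞ :=
  eLpNorm (weightedFun p ω f) (ENNReal.ofReal p) (volume.restrict (Ioi 0))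

/-- Membership in `L^p(ℝ₊, ω)`. -/
def WMem (p : ℝ) (ω f : ℝ → ℝ) : Prop :=
  MemLp (weightedFun p ω f) (ENNReal.ofReal p) (volume.restrict (Ioi 0))

section WeightedSpace

variable {p : ℝ} {ω : ℝ → ℝ}

lemma one_le_ofReal_exponent (hp : 1 < p) : 1 ≤ ENNReal.ofReal p := by
  rw [ENNReal.one_le_ofReal]; exact hp.le

lemma weightedFun_add (f g : ℝ → ℝ) :
    weightedFun p ω (f + g) = weightedFun p ω f + weightedFun p ω g := by
  funext t; simp [weightedFun, add_mul]

lemma weightedFun_sub (f g : ℝ → ℝ) :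
    weightedFun p ω (f - g) = weightedFun p ω f - weightedFun p ω g := by
  funext t; simp [weightedFun, sub_mul]

lemma weightedFun_smul (k : ℝ) (f : ℝ → ℝ) :
    weightedFun p ω (k • f) = k • weightedFun p ω f := by
  funext t; simp [weightedFun, mul_assoc]

lemma WMem.add {f g : ℝ → ℝ} (hf : WMem p ω f) (hg : WMem p ω g) : WMem p ω (f + g) := by
  rw [WMem, weightedFun_add]; exact MemLp.add hf hg

lemma WMem.sub {f g : ℝ → ℝ} (hf : WMem p ω f) (hg : WMem p ω g) : WMem p ω (f - g) := by
  rw [WMem, weightedFun_sub]; exact MemLp.sub hf hg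

lemma WMem.smul {f : ℝ → ℝ} (k : ℝ) (hf : WMem p ω f) : WMem p ω (k • f) := by
  rw [WMem, weightedFun_smul]; exact MemLp.const_smul hf k

lemma wMem_zero : WMem p ω 0 := by
  have : weightedFun p ω 0 = 0 := by funext t; simp [weightedFun]
  rw [WMem, this]; exact MemLp.zero

lemma wnorm_zero : wnorm p ω 0 = 0 := by
  have : weightedFun p ω 0 = 0 := by funext t; simp [weightedFun]
  rw [wnorm, this]; simp

lemma wnorm_add_le (hp : 1 < p) {f g : ℝ → ℝ} (hf : WMem p ω f) (hg : WMem p ω g) :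
    wnorm p ω (f + g) ≤ wnorm p ω f + wnorm p ω g := by
  rw [wnorm, weightedFun_add]
  exact eLpNorm_add_le hf.1 hg.1 (one_le_ofReal_exponent hp)

lemma wnorm_sub_le (hp : 1 < p) {f g : ℝ → ℝ} (hf : WMem p ω f) (hg : WMem p ω g) :
    wnorm p ω (f - g) ≤ wnorm p ω f + wnorm p ω g := by
  rw [wnorm, weightedFun_sub]
  exact eLpNorm_sub_le hf.1 hg.1 (one_le_ofReal_exponent hp)

lemma wnorm_smul (k : ℝ) (f : ℝ → ℝ) :
    wnorm p ω (k • f) = ENNReal.ofReal |k| * wnorm p ω f := by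
  rw [wnorm, weightedFun_smul, eLpNorm_const_smul, ← Real.enorm_eq_ofReal_abs]; rfl

lemma IsWeight.continuousOn_rpow (hω : IsWeight ω) (s : ℝ) :
    ContinuousOn (fun t => ω t ^ s) (Ioi 0) :=
  hω.1.rpow_const fun t ht => Or.inl (hω.2 t ht).ne'

lemma IsWeight.aestronglyMeasurable_rpow (hω : IsWeight ω) (s : ℝ) :
    AEStronglyMeasurable (fun t => ω t ^ s) (volume.restrict (Ioi 0)) :=
  (hω.continuousOn_rpow s).aestronglyMeasurable measurableSet_Ioi

lemma WMem.aestronglyMeasurable (hω : IsWeight ω) {f : ℝ → ℝ} (hf : WMem p ω f) :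
    AEStronglyMeasurable f (volume.restrict (Ioi 0)) := by
  refine (hf.1.mul (hω.aestronglyMeasurable_rpow (-(1 / p)))).congr ?_
  filter_upwards [ae_restrict_mem measurableSet_Ioi] with t ht
  have := hω.2 t ht
  simp only [weightedFun, Pi.mul_apply, mul_assoc]
  rw [← Real.rpow_add this]; simp

lemma norm_weightedFun_rpow (hp : 1 < p) (hω : IsWeight ω) (f : ℝ → ℝ) {t : ℝ} (ht : 0 < t) :
    ‖weightedFun p ω f t‖ ^ p = |f t| ^ p * ω t := by
  have hw := hω.2 t ht
  have hp0 : p ≠ 0 := by linarith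
  rw [weightedFun, norm_mul, Real.norm_eq_abs, Real.norm_eq_abs,
    abs_of_pos (Real.rpow_pos_of_pos hw _), Real.mul_rpow (abs_nonneg _) (by positivity),
    ← Real.rpow_mul hw.le, one_div_mul_cancel hp0, Real.rpow_one]

lemma wMem_of_integrableOn (hp : 1 < p) (hω : IsWeight ω) {f : ℝ → ℝ}
    (hf : AEStronglyMeasurable f (volume.restrict (Ioi 0)))
    (hi : IntegrableOn (fun t => |f t| ^ p * ω t) (Ioi 0)) : WMem p ω f := by
  have h0 : ENNReal.ofReal p ≠ 0 := (zero_lt_one.trans_le (one_le_ofReal_exponent hp)).ne'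
  have hm : AEStronglyMeasurable (weightedFun p ω f) (volume.restrict (Ioi 0)) :=
    hf.mul (hω.aestronglyMeasurable_rpow _)
  rw [WMem, ← integrable_norm_rpow_iff hm h0 ENNReal.ofReal_ne_top,
    ENNReal.toReal_ofReal (by linarith)]
  refine hi.congr ?_
  filter_upwards [ae_restrict_mem measurableSet_Ioi] with t ht
  exact (norm_weightedFun_rpow hp hω f ht).symm

lemma wnorm_eq (hp : 1 < p) (hω : IsWeight ω) {f : ℝ → ℝ} (hf : WMem p ω f) :
    wnorm p ω f = ENNReal.ofReal ((∫ t in Ioi 0, |f t| ^ p * ω t) ^ (1 / p)) := by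
  have h0 : ENNReal.ofReal p ≠ 0 := (zero_lt_one.trans_le (one_le_ofReal_exponent hp)).ne'
  rw [wnorm, MemLp.eLpNorm_eq_integral_rpow_norm h0 ENNReal.ofReal_ne_top hf,
    ENNReal.toReal_ofReal (by linarith), one_div]
  congr 2
  exact setIntegral_congr_fun measurableSet_Ioi fun t ht => norm_weightedFun_rpow hp hω f ht

lemma integral_nonneg_of_isWeight (hω : IsWeight ω) (f : ℝ → ℝ) :
    0 ≤ ∫ t in Ioi 0, |f t| ^ p * ω t :=
  setIntegral_nonneg measurableSet_Ioi fun t ht =>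
    mul_nonneg (Real.rpow_nonneg (abs_nonneg _) _) (hω.2 t ht).le

lemma tendsto_wnorm_iff (hp : 1 < p) (hω : IsWeight ω) {f : ℕ → ℝ → ℝ}
    (hf : ∀ n, WMem p ω (f n)) :
    Tendsto (fun n => wnorm p ω (f n)) atTop (𝓝 0) ↔
      Tendsto (fun n => ∫ t in Ioi 0, |f n t| ^ p * ω t) atTop (𝓝 0) := by
  have hp0 : 0 < p := by linarith
  constructor
  · intro h
    have h1 := ((ENNReal.tendsto_toReal ENNReal.zero_ne_top).comp h).rpow_const
      (p := p) (Or.inr hp0.le)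
    simp only [ENNReal.toReal_zero, Real.zero_rpow hp0.ne'] at h1
    refine h1.congr fun n => ?_
    have h2 := integral_nonneg_of_isWeight (p := p) hω (f n)
    simp only [Function.comp]
    rw [wnorm_eq hp hω (hf n), ENNReal.toReal_ofReal (by positivity), ← Real.rpow_mul h2,
      one_div_mul_cancel hp0.ne', Real.rpow_one]
  · intro h
    have h1 := ENNReal.tendsto_ofReal (h.rpow_const (p := 1 / p) (Or.inr (by positivity)))
    rw [Real.zero_rpow (by positivity), ENNReal.ofReal_zero] at h1
    exact h1.congr fun n => (wnorm_eq hp hω (hf n)).symm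

lemma MemD.wMem (hp : 1 < p) (hω : IsWeight ω) {u u' : ℝ → ℝ} (h : MemD p ω u u') :
    WMem p ω u' := by
  refine wMem_of_integrableOn hp hω ?_ h.2.2
  have : Ioi (0 : ℝ) ⊆ ⋃ n : ℕ, Ioc (1 / ((n : ℝ) + 1)) (n + 2) := by
    intro t ht
    obtain ⟨n, hn⟩ := exists_nat_one_div_lt (show (0 : ℝ) < t from ht)
    obtain ⟨m, hm⟩ := exists_nat_ge t
    refine mem_iUnion.2 ⟨max n m, ?_, ?_⟩
    · refine lt_of_le_of_lt ?_ hn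
      apply one_div_le_one_div_of_le (by positivity)
      push_cast; gcongr; exact le_max_left _ _
    · push_cast
      linarith [le_max_right (n : ℝ) (m : ℝ)]
  refine AEStronglyMeasurable.mono_set this (aestronglyMeasurable_iUnion_iff.2 fun n => ?_)
  refine (h.1 _ _ (by positivity) ?_).aestronglyMeasurable
  have : 1 / ((n : ℝ) + 1) ≤ 1 := by
    rw [div_le_one (by positivity)]; linarith [n.cast_nonneg (α := ℝ)]
  linarith [n.cast_nonneg (α := ℝ)]

/-- Hölder's inequality with the dual weight `ω^{-1/(p-1)}`. -/
lemma exists_eLpNorm_one_le (hp : 1 < p) (hω : IsWeight ω) {E : Set ℝ} (hE : MeasurableSet E)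
    (hE0 : E ⊆ Ioi 0) (hσ : IntegrableOn (fun t => ω t ^ (-1 / (p - 1))) E) :
    ∃ C : ℝ≥0∞, C ≠ ∞ ∧ ∀ f, WMem p ω f →
      eLpNorm f 1 (volume.restrict E) ≤ C * wnorm p ω f := by
  have hpq : p.HolderConjugate (p / (p - 1)) := Real.HolderConjugate.conjExponent hp
  have hq0 : 0 < p / (p - 1) := hpq.symm.pos
  have : ENNReal.HolderConjugate (ENNReal.ofReal p) (ENNReal.ofReal (p / (p - 1))) :=
    hpq.ennrealOfReal
  have hle : volume.restrict E ≤ volume.restrict (Ioi (0 : ℝ)) := Measure.restrict_mono hE0 le_rfl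
  have hm := (hω.aestronglyMeasurable_rpow (-(1 / p))).mono_measure hle
  have hL : MemLp (fun t => ω t ^ (-(1 / p))) (ENNReal.ofReal (p / (p - 1)))
      (volume.restrict E) := by
    rw [← integrable_norm_rpow_iff hm (by simpa using hq0) ENNReal.ofReal_ne_top,
      ENNReal.toReal_ofReal hq0.le]
    refine hσ.congr ?_
    filter_upwards [ae_restrict_mem hE] with t ht
    have hw := hω.2 t (hE0 ht)
    rw [Real.norm_eq_abs, abs_of_pos (Real.rpow_pos_of_pos hw _), ← Real.rpow_mul hw.le]
    congr 1
    have : p - 1 ≠ 0 := by linarith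
    have : p ≠ 0 := by linarith
    field_simp
  refine ⟨_, hL.eLpNorm_ne_top, fun f hf => ?_⟩
  have hmf := hf.1.mono_measure hle
  calc eLpNorm f 1 (volume.restrict E)
      = eLpNorm (weightedFun p ω f • fun t => ω t ^ (-(1 / p))) 1 (volume.restrict E) := by
        refine eLpNorm_congr_ae ?_
        filter_upwards [ae_restrict_mem hE] with t ht
        have hw := hω.2 t (hE0 ht)
        simp only [weightedFun, Pi.smul_apply', smul_eq_mul, mul_assoc]
        rw [← Real.rpow_add hw]; simp
    _ ≤ _ := eLpNorm_smul_le_mul_eLpNorm hm hmf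
    _ ≤ _ := by
        rw [mul_comm]
        gcongr
        exact eLpNorm_mono_measure _ hle

lemma WMem.integrableOn (hp : 1 < p) (hω : IsWeight ω) {E : Set ℝ} (hE : MeasurableSet E)
    (hE0 : E ⊆ Ioi 0) (hσ : IntegrableOn (fun t => ω t ^ (-1 / (p - 1))) E) {f : ℝ → ℝ}
    (hf : WMem p ω f) : IntegrableOn f E := by
  obtain ⟨C, hC, h⟩ := exists_eLpNorm_one_le hp hω hE hE0 hσ
  refine memLp_one_iff_integrable.1 ⟨(hf.aestronglyMeasurable hω).mono_set hE0, ?_⟩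
  exact (h f hf).trans_lt (ENNReal.mul_lt_top hC.lt_top hf.2)

lemma IsWeight.integrableOn_Icc (hω : IsWeight ω) (s : ℝ) {c d : ℝ} (hc : 0 < c) :
    IntegrableOn (fun t => ω t ^ s) (Icc c d) :=
  ((hω.continuousOn_rpow s).mono fun _ ht => hc.trans_le ht.1).integrableOn_Icc

/-- On compact subintervals of `ℝ₊` the weighted and unweighted norms are equivalent. -/
lemma exists_norm_rpow_le (hω : IsWeight ω) (s : ℝ) {c d : ℝ} (hc : 0 < c) :
    ∃ C : ℝ, 0 < C ∧ ∀ t ∈ Icc c d, ‖ω t ^ s‖ ≤ C := by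
  obtain ⟨C, hC⟩ := isCompact_Icc.exists_bound_of_continuousOn
    ((hω.continuousOn_rpow s).mono fun t (ht : t ∈ Icc c d) => hc.trans_le ht.1)
  exact ⟨max C 1, by positivity, fun t ht => (hC t ht).trans (le_max_left _ _)⟩

lemma exists_wnorm_le (hω : IsWeight ω) {c d : ℝ} (hc : 0 < c) :
    ∃ C : ℝ, 0 < C ∧ ∀ f : ℝ → ℝ, (∀ t, t ∉ Icc c d → f t = 0) →
      wnorm p ω f ≤ ENNReal.ofReal C * eLpNorm f (ENNReal.ofReal p) volume := by
  obtain ⟨C, hC0, hC⟩ := exists_norm_rpow_le hω (1 / p) (d := d) hc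
  refine ⟨C, hC0, fun f hf => ?_⟩
  refine (eLpNorm_mono_measure _ Measure.restrict_le_self).trans
    (eLpNorm_le_mul_eLpNorm_of_ae_le_mul (Eventually.of_forall fun t => ?_) _)
  by_cases ht : t ∈ Icc c d
  · rw [weightedFun, norm_mul, mul_comm]
    gcongr; exact hC t ht
  · simp [weightedFun, hf t ht]

lemma wMem_of_memLp (hω : IsWeight ω) {c d : ℝ} (hc : 0 < c) {f : ℝ → ℝ}
    (hf0 : ∀ t, t ∉ Icc c d → f t = 0) (hf : MemLp f (ENNReal.ofReal p)) : WMem p ω f := by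
  obtain ⟨C, -, h⟩ := exists_wnorm_le (p := p) hω (d := d) hc
  exact ⟨(hf.1.mono_measure Measure.restrict_le_self).mul (hω.aestronglyMeasurable_rpow _),
    (h f hf0).trans_lt (ENNReal.mul_lt_top ENNReal.ofReal_lt_top hf.2)⟩

lemma WMem.memLp (hω : IsWeight ω) {c d : ℝ} (hc : 0 < c) {f : ℝ → ℝ}
    (hf0 : ∀ t, t ∉ Icc c d → f t = 0) (hf : WMem p ω f) : MemLp f (ENNReal.ofReal p) := by
  obtain ⟨C, hC0, hC⟩ := exists_norm_rpow_le hω (-(1 / p)) (d := d) hc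
  have hsub : Icc c d ⊆ Ioi 0 := fun t ht => hc.trans_le ht.1
  have hind : f = (Ioi (0 : ℝ)).indicator f := by
    refine (indicator_eq_self.2 fun t ht => ?_).symm
    by_contra h
    exact ht (hf0 t fun h' => h (hsub h'))
  rw [hind, memLp_indicator_iff_restrict measurableSet_Ioi]
  refine MemLp.of_le_mul (c := C) hf (hf.aestronglyMeasurable hω) ?_
  filter_upwards with t
  by_cases ht : t ∈ Icc c d
  · have hw := hω.2 t (hsub ht)
    have : f t = ω t ^ (-(1 / p)) * weightedFun p ω f t := by
      rw [weightedFun, mul_left_comm, ← Real.rpow_add hw]; simp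
    conv_lhs => rw [this]
    rw [norm_mul]
    gcongr; exact hC t ht
  · rw [hf0 t ht, norm_zero]; positivity

lemma exists_subset_Icc_of_isCompact {K : Set ℝ} (hK : IsCompact K) (hK0 : K ⊆ Ioi 0) :
    ∃ c d : ℝ, 0 < c ∧ K ⊆ Icc c d := by
  rcases K.eq_empty_or_nonempty with h | h
  · exact ⟨1, 1, one_pos, by simp [h]⟩
  · obtain ⟨c, hc, hc'⟩ := hK.exists_isLeast h
    obtain ⟨d, hd, hd'⟩ := hK.exists_isGreatest h
    exact ⟨c, d, hK0 hc, fun t ht => ⟨hc' ht, hd' ht⟩⟩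

lemma Continuous.wMem (hω : IsWeight ω) {f : ℝ → ℝ} (hf : Continuous f)
    (hs : HasCompactSupport f) (hs0 : tsupport f ⊆ Ioi 0) : WMem p ω f := by
  obtain ⟨c, d, hc, h⟩ := exists_subset_Icc_of_isCompact hs.isCompact hs0
  exact wMem_of_memLp hω hc (fun t ht => image_eq_zero_of_notMem_tsupport fun h' => ht (h h'))
    (hf.memLp_of_hasCompactSupport hs)

lemma tendsto_setIntegral_of_wnorm (hp : 1 < p) (hω : IsWeight ω) {E : Set ℝ}
    (hE : MeasurableSet E) (hE0 : E ⊆ Ioi 0)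
    (hσ : IntegrableOn (fun t => ω t ^ (-1 / (p - 1))) E) {f : ℕ → ℝ → ℝ} {g : ℝ → ℝ}
    (hf : ∀ n, WMem p ω (f n)) (hg : WMem p ω g)
    (h : Tendsto (fun n => wnorm p ω (f n - g)) atTop (𝓝 0)) :
    Tendsto (fun n => ∫ t in E, f n t) atTop (𝓝 (∫ t in E, g t)) := by
  obtain ⟨C, hC, hle⟩ := exists_eLpNorm_one_le hp hω hE hE0 hσ
  refine tendsto_integral_of_L1' g (hg.integrableOn hp hω hE hE0 hσ).aestronglyMeasurable
    (Eventually.of_forall fun n => (hf n).integrableOn hp hω hE hE0 hσ) ?_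
  have h1 := ENNReal.Tendsto.const_mul (a := C) h (Or.inr hC)
  rw [mul_zero] at h1
  exact tendsto_of_tendsto_of_tendsto_of_le_of_le tendsto_const_nhds h1 (fun _ => zero_le)
    fun n => hle _ ((hf n).sub hg)

/-- On functions supported in a fixed compact subinterval of `ℝ₊`, the `L¹` norm is controlled
by the weighted norm. -/
lemma exists_integral_abs_le (hp : 1 < p) (hω : IsWeight ω) {c d : ℝ} (hc : 0 < c) :
    ∃ C : ℝ, 0 < C ∧ ∀ (f : ℝ → ℝ) (δ : ℝ), 0 ≤ δ → (∀ t, t ∉ Icc c d → f t = 0) →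
      WMem p ω f → wnorm p ω f ≤ ENNReal.ofReal δ → ∫ t, |f t| ≤ C * δ := by
  obtain ⟨C, hC, hle⟩ := exists_eLpNorm_one_le hp hω (measurableSet_Icc (a := c) (b := d))
    (fun t ht => hc.trans_le ht.1) (hω.integrableOn_Icc _ hc)
  refine ⟨C.toReal + 1, by positivity, fun f δ hδ hf0 hf hfδ => ?_⟩
  have hi : IntegrableOn f (Icc c d) := hf.integrableOn hp hω measurableSet_Icc
    (fun t ht => hc.trans_le ht.1) (hω.integrableOn_Icc _ hc)
  have h1 : ∫ t, |f t| = ∫ t in Icc c d, ‖f t‖ :=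
    (setIntegral_eq_integral_of_forall_compl_eq_zero fun t ht => by simp [hf0 t ht]).symm
  rw [h1, integral_norm_eq_lintegral_enorm hi.aestronglyMeasurable, ← eLpNorm_one_eq_lintegral_enorm]
  calc (eLpNorm f 1 (volume.restrict (Icc c d))).toReal ≤ (C * ENNReal.ofReal δ).toReal := by
        refine ENNReal.toReal_mono (ENNReal.mul_ne_top hC ENNReal.ofReal_ne_top) ?_
        exact (hle f hf).trans (by gcongr)
    _ = C.toReal * δ := by rw [ENNReal.toReal_mul, ENNReal.toReal_ofReal hδ]
    _ ≤ (C.toReal + 1) * δ := by gcongr; linarith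

lemma WMem.integrable (hp : 1 < p) (hω : IsWeight ω) {c d : ℝ} (hc : 0 < c) {f : ℝ → ℝ}
    (hf0 : ∀ t, t ∉ Icc c d → f t = 0) (hf : WMem p ω f) : Integrable f := by
  rw [← integrableOn_iff_integrable_of_support_subset (s := Icc c d)
    (fun t ht => by by_contra h; exact ht (hf0 t h))]
  exact hf.integrableOn hp hω measurableSet_Icc
    (fun t ht => hc.trans_le ht.1) (hω.integrableOn_Icc _ hc)

/-- Smooth functions with compact support are dense in `L^p(ℝ₊, ω)`. -/
lemma exists_contDiff_wnorm_sub_le (hp : 1 < p) (hω : IsWeight ω) {c d : ℝ} (hc : 0 < c)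
    (hcd : c < d) {g : ℝ → ℝ} (hg0 : ∀ t, t ∉ Icc c d → g t = 0) (hg : WMem p ω g)
    {ε : ℝ} (hε : 0 < ε) :
    ∃ (ψ : ℝ → ℝ) (a b : ℝ), 0 < a ∧ ContDiff ℝ (⊤ : ℕ∞) ψ ∧ (∀ t, t ∉ Icc a b → ψ t = 0) ∧
      WMem p ω ψ ∧ wnorm p ω (ψ - g) ≤ ENNReal.ofReal ε ∧ ∫ t, |(ψ - g) t| ≤ ε := by
  let χ : ContDiffBump ((c + d) / 2) :=
    ⟨(d - c) / 2, d / 2, by linarith, by linarith⟩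
  have ha : 0 < c / 2 := by linarith
  have hχ1 : ∀ t ∈ Icc c d, χ t = 1 := fun t ht => by
    apply χ.one_of_mem_closedBall
    rw [Real.closedBall_eq_Icc]
    constructor <;> simp only [χ] <;> linarith [ht.1, ht.2]
  have hχ0 : ∀ t, t ∉ Icc (c / 2) (c / 2 + d) → χ t = 0 := fun t ht => by
    apply χ.zero_of_le_dist
    by_contra! h
    rw [Real.dist_eq, abs_lt] at h
    simp only [χ] at h
    exact ht ⟨by linarith [h.1], by linarith [h.2]⟩
  obtain ⟨C₁, hC₁, h₁⟩ := exists_wnorm_le (p := p) hω (d := c / 2 + d) ha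
  obtain ⟨C₂, hC₂, h₂⟩ := exists_integral_abs_le hp hω (d := c / 2 + d) ha
  set δ := min ε (ε / C₂)
  have hδ : 0 < δ := by positivity
  obtain ⟨ψ, hψc, hψ, hψg⟩ := (hg.memLp hω hc hg0).exist_eLpNorm_sub_le ENNReal.ofReal_ne_top
    (one_le_ofReal_exponent hp) (show 0 < δ / C₁ by positivity)
  have hsm : ContDiff ℝ (⊤ : ℕ∞) (fun t => χ t * ψ t) := χ.contDiff.mul hψ
  have hψ0 : ∀ t, t ∉ Icc (c / 2) (c / 2 + d) → χ t * ψ t = 0 := fun t ht => by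
    rw [hχ0 t ht, zero_mul]
  have hψW : WMem p ω (fun t => χ t * ψ t) := wMem_of_memLp hω ha hψ0
    (hsm.continuous.memLp_of_hasCompactSupport hψc.mul_left)
  have hd0 : ∀ t, t ∉ Icc (c / 2) (c / 2 + d) → ((fun t => χ t * ψ t) - g) t = 0 := fun t ht => by
    rw [Pi.sub_apply, hψ0 t ht, hg0 t fun h => ht ⟨by linarith [h.1], by linarith [h.2]⟩, sub_zero]
  have hδw : wnorm p ω ((fun t => χ t * ψ t) - g) ≤ ENNReal.ofReal δ := by
    calc _ ≤ ENNReal.ofReal C₁ * eLpNorm ((fun t => χ t * ψ t) - g) (ENNReal.ofReal p) volume :=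
          h₁ _ hd0
      _ ≤ ENNReal.ofReal C₁ * ENNReal.ofReal (δ / C₁) := by
          gcongr
          refine le_trans (eLpNorm_mono fun t => ?_) hψg
          by_cases ht : t ∈ Icc c d
          · simp [hχ1 t ht, abs_sub_comm]
          · simp only [Pi.sub_apply, hg0 t ht, sub_zero, zero_sub, norm_neg, norm_mul]
            refine mul_le_of_le_one_left (norm_nonneg _) ?_
            rw [Real.norm_of_nonneg χ.nonneg]
            exact χ.le_one
      _ = ENNReal.ofReal δ := by
          rw [← ENNReal.ofReal_mul hC₁.le]; congr 1; field_simp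
  refine ⟨fun t => χ t * ψ t, c / 2, c / 2 + d, ha, hsm, hψ0, hψW,
    hδw.trans (ENNReal.ofReal_le_ofReal (min_le_left _ _)), ?_⟩
  refine (h₂ _ _ hδ.le hd0 (hψW.sub hg) hδw).trans ?_
  calc C₂ * δ ≤ C₂ * (ε / C₂) := by gcongr; exact min_le_right _ _
    _ = ε := by field_simp

lemma exists_primitive {ψ : ℝ → ℝ} (hψ : ContDiff ℝ (⊤ : ℕ∞) ψ) {a b : ℝ} (ha : 0 < a)
    (hψ0 : ∀ t, t ∉ Icc a b → ψ t = 0) (hint : ∫ t, ψ t = 0) :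
    ∃ φ : ℝ → ℝ, (ContDiff ℝ (⊤ : ℕ∞) φ ∧ HasCompactSupport φ ∧ tsupport φ ⊆ Ioi 0) ∧
      deriv φ = ψ ∧ ∀ t, 0 < t → φ t = ∫ s in Ioc 0 t, ψ s := by
  have hd : deriv (fun t => ∫ s in (0 : ℝ)..t, ψ s) = ψ := by
    funext t; exact hψ.continuous.deriv_integral _ _ _
  have hsupp : tsupport (fun t => ∫ s in (0 : ℝ)..t, ψ s) ⊆ Icc a b := by
    refine closure_minimal (fun t ht => ?_) isClosed_Icc
    by_contra h
    apply ht
    simp only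
    rcases lt_or_ge t a with hta | hta
    · refine intervalIntegral.integral_zero_ae (Eventually.of_forall fun s hs => hψ0 s fun h' => ?_)
      have := h'.1
      have := hs.2
      rcases le_total 0 t with h0 | h0
      · rw [max_eq_right h0] at this; linarith
      · rw [max_eq_left h0] at this; linarith
    · have hbt : b < t := by
        by_contra! h'; exact h ⟨hta, h'⟩
      rw [intervalIntegral.integral_of_le (by linarith),
        setIntegral_eq_integral_of_forall_compl_eq_zero, hint]
      intro s hs
      exact hψ0 s fun h' => hs ⟨by linarith [h'.1], by linarith [h'.2]⟩
  refine ⟨fun t => ∫ s in (0 : ℝ)..t, ψ s, ⟨?_, ?_, ?_⟩, hd, fun t ht => ?_⟩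
  · rw [contDiff_infty_iff_deriv, hd]
    exact ⟨fun t => (intervalIntegral.integral_hasDerivAt_right
      (hψ.continuous.intervalIntegrable _ _) (hψ.continuous.stronglyMeasurableAtFilter _ _)
      hψ.continuous.continuousAt).differentiableAt, hψ⟩
  · exact isCompact_Icc.of_isClosed_subset (isClosed_tsupport _) hsupp
  · exact hsupp.trans fun t ht => ha.trans_le ht.1
  · exact intervalIntegral.integral_of_le ht.le

lemma wMem_deriv (hω : IsWeight ω) {φ : ℝ → ℝ} (hφ : ContDiff ℝ (⊤ : ℕ∞) φ)
    (hφc : HasCompactSupport φ) (hφ0 : tsupport φ ⊆ Ioi 0) : WMem p ω (deriv φ) :=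
  (hφ.continuous_deriv (by simp)).wMem hω hφc.deriv
    (tsupport_deriv_subset.trans hφ0)

lemma exists_approximation (hp : 1 < p) (hω : IsWeight ω) {u' : ℝ → ℝ} (hu' : WMem p ω u') :
    ∃ K : ℝ, 0 < K ∧ ∀ (ε c d : ℝ) (g : ℝ → ℝ), 0 < ε → 0 < c → c < d →
      (∀ t, t ∉ Icc c d → g t = 0) → WMem p ω g → wnorm p ω (g - u') ≤ ENNReal.ofReal ε →
      |∫ t, g t| ≤ ε →
      ∃ φ : ℝ → ℝ, (ContDiff ℝ (⊤ : ℕ∞) φ ∧ HasCompactSupport φ ∧ tsupport φ ⊆ Ioi 0) ∧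
        wnorm p ω (deriv φ - u') ≤ ENNReal.ofReal (K * ε) ∧
        ∀ t, 0 < t → |φ t - ∫ s in Ioc 0 t, g s| ≤ 3 * ε := by
  let B : ContDiffBump (3 / 2 : ℝ) := ⟨1 / 4, 1 / 2, by norm_num, by norm_num⟩
  set η : ℝ → ℝ := B.normed volume with hη
  have hηs : ContDiff ℝ (⊤ : ℕ∞) η := B.contDiff_normed
  have hη1 : ∫ t, η t = 1 := B.integral_normed
  have hηsupp : tsupport η ⊆ Icc 1 2 := by
    rw [hη, B.tsupport_normed_eq, Real.closedBall_eq_Icc]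
    apply Icc_subset_Icc <;> norm_num [B]
  have hη0 : ∀ t, t ∉ Icc (1 : ℝ) 2 → η t = 0 := fun t ht =>
    image_eq_zero_of_notMem_tsupport fun h' => ht (hηsupp h')
  have hηW : WMem p ω η := hηs.continuous.wMem hω B.hasCompactSupport_normed
    (hηsupp.trans fun t ht => one_pos.trans_le ht.1)
  have hηi : Integrable η := hηW.integrable hp hω one_pos hη0
  have hK : wnorm p ω η = ENNReal.ofReal (wnorm p ω η).toReal :=
    (ENNReal.ofReal_toReal hηW.eLpNorm_ne_top).symm
  set K := (wnorm p ω η).toReal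
  have hK0 : 0 ≤ K := ENNReal.toReal_nonneg
  refine ⟨2 + 2 * K, by positivity, fun ε c d g hε hc hcd hg0 hg hgu hgi => ?_⟩
  obtain ⟨ψ, a, b, ha, hψs, hψ0, hψW, hψg, hψi⟩ :=
    exists_contDiff_wnorm_sub_le hp hω hc hcd hg0 hg hε
  have hψI : Integrable ψ := hψW.integrable hp hω ha hψ0
  have hgI : Integrable g := hg.integrable hp hω hc hg0
  set k := ∫ t, ψ t
  have hk : |k| ≤ 2 * ε := by
    have h1 : k = (∫ t, (ψ - g) t) + ∫ t, g t := by
      rw [← integral_add (hψI.sub hgI) hgI]; simp [k]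
    have h2 : |∫ t, (ψ - g) t| ≤ ∫ t, |(ψ - g) t| := abs_integral_le_integral_abs
    rw [h1]
    linarith [abs_add_le (∫ t, (ψ - g) t) (∫ t, g t)]
  have hs : ContDiff ℝ (⊤ : ℕ∞) (ψ - k • η) := hψs.sub (contDiff_const.smul hηs)
  have h0 : ∀ t, t ∉ Icc (min a 1) (max b 2) → (ψ - k • η) t = 0 := fun t ht => by
    have h1 := hψ0 t fun h => ht ⟨(min_le_left _ _).trans h.1, h.2.trans (le_max_left _ _)⟩
    have h2 := hη0 t fun h => ht ⟨(min_le_right _ _).trans h.1, h.2.trans (le_max_right _ _)⟩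
    simp [h1, h2]
  have hint : ∫ t, (ψ - k • η) t = 0 := by
    have : ∫ t, (ψ - k • η) t = (∫ t, ψ t) - ∫ t, (k • η) t :=
      integral_sub hψI (hηi.smul k)
    rw [this]
    simp [integral_const_mul, hη1, k]
  obtain ⟨φ, hφ, hφd, hφi⟩ := exists_primitive hs (lt_min ha one_pos) h0 hint
  refine ⟨φ, hφ, ?_, fun t ht => ?_⟩
  · have : deriv φ - u' = (ψ - g) + (g - u') - k • η := by rw [hφd]; abel
    rw [this]
    calc _ ≤ wnorm p ω (ψ - g) + wnorm p ω (g - u') + wnorm p ω (k • η) := by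
          refine (wnorm_sub_le hp ((hψW.sub hg).add (hg.sub hu')) (hηW.smul k)).trans ?_
          gcongr
          exact wnorm_add_le hp (hψW.sub hg) (hg.sub hu')
      _ ≤ ENNReal.ofReal ε + ENNReal.ofReal ε + ENNReal.ofReal (2 * ε) * ENNReal.ofReal K := by
          rw [wnorm_smul, ← hK]
          gcongr
      _ = ENNReal.ofReal ((2 + 2 * K) * ε) := by
          rw [← ENNReal.ofReal_mul (by positivity), ← ENNReal.ofReal_add hε.le hε.le,
            ← ENNReal.ofReal_add (by positivity) (by positivity)]
          congr 1; ring
  · have h1 : φ t - ∫ s in Ioc 0 t, g s =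
        (∫ s in Ioc 0 t, (ψ - g) s) - k * ∫ s in Ioc 0 t, η s := by
      rw [hφi t ht]
      have e1 : ∫ s in Ioc 0 t, (ψ - k • η) s =
          (∫ s in Ioc 0 t, ψ s) - ∫ s in Ioc 0 t, (k • η) s :=
        integral_sub hψI.integrableOn (hηi.smul k).integrableOn
      have e2 : ∫ s in Ioc 0 t, (ψ - g) s =
          (∫ s in Ioc 0 t, ψ s) - ∫ s in Ioc 0 t, g s :=
        integral_sub hψI.integrableOn hgI.integrableOn
      rw [e1, e2]
      simp only [Pi.smul_apply, smul_eq_mul, integral_const_mul]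
      ring
    have h2 : |∫ s in Ioc 0 t, (ψ - g) s| ≤ ε := by
      refine abs_integral_le_integral_abs.trans (le_trans ?_ hψi)
      exact setIntegral_le_integral (hψI.sub hgI).abs (Eventually.of_forall fun s => abs_nonneg _)
    have h3 : ∫ s in Ioc 0 t, η s ≤ 1 := hη1 ▸
      setIntegral_le_integral hηi (Eventually.of_forall fun s => B.nonneg_normed s)
    have h4 : 0 ≤ ∫ s in Ioc 0 t, η s := integral_nonneg fun s => B.nonneg_normed s
    rw [h1]
    calc _ ≤ |∫ s in Ioc 0 t, (ψ - g) s| + |k| * ∫ s in Ioc 0 t, η s := by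
          refine (abs_sub _ _).trans ?_
          rw [abs_mul, abs_of_nonneg h4]
      _ ≤ ε + 2 * ε * 1 := by gcongr
      _ = 3 * ε := by ring

lemma memD0_of_approximation (hp : 1 < p) (hω : IsWeight ω) {u u' : ℝ → ℝ} (hu : MemD p ω u u')
    (h : ∀ ε a b : ℝ, 0 < ε → 0 < a → a < b → ∃ (g : ℝ → ℝ) (c d : ℝ), 0 < c ∧ c < d ∧
      (∀ t, t ∉ Icc c d → g t = 0) ∧ WMem p ω g ∧ wnorm p ω (g - u') ≤ ENNReal.ofReal ε ∧
      |∫ t, g t| ≤ ε ∧ ∀ t ∈ Icc a b, |(∫ s in Ioc 0 t, g s) - u t| ≤ ε) :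
    MemD0 p ω u u' := by
  have hu' := hu.wMem hp hω
  obtain ⟨K, hK, happ⟩ := exists_approximation hp hω hu'
  have hpos : ∀ n : ℕ, (0 : ℝ) < 1 / ((n : ℝ) + 1) := fun n => by positivity
  have hex : ∀ n : ℕ, ∃ φ : ℝ → ℝ,
      (ContDiff ℝ (⊤ : ℕ∞) φ ∧ HasCompactSupport φ ∧ tsupport φ ⊆ Ioi 0) ∧
      wnorm p ω (deriv φ - u') ≤ ENNReal.ofReal (K * (1 / ((n : ℝ) + 1))) ∧
      ∀ t ∈ Icc (1 / ((n : ℝ) + 1)) ((n : ℝ) + 2), |φ t - u t| ≤ 4 * (1 / ((n : ℝ) + 1)) := by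
    intro n
    have hlt : 1 / ((n : ℝ) + 1) < (n : ℝ) + 2 := by
      rw [div_lt_iff₀ (by positivity)]; nlinarith [n.cast_nonneg (α := ℝ)]
    obtain ⟨g, c, d, hc, hcd, hg0, hg, hgu, hgi, hgt⟩ := h _ _ _ (hpos n) (hpos n) hlt
    obtain ⟨φ, hφ, hφw, hφt⟩ := happ _ c d g (hpos n) hc hcd hg0 hg hgu hgi
    refine ⟨φ, hφ, hφw, fun t ht => ?_⟩
    have h1 := hφt t ((hpos n).trans_le ht.1)
    have h2 := hgt t ht
    linarith [abs_sub_le (φ t) (∫ s in Ioc 0 t, g s) (u t)]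
  choose φ hφ hφw hφt using hex
  have hlim : ∀ k : ℝ, Tendsto (fun n : ℕ => k * (1 / ((n : ℝ) + 1))) atTop (𝓝 0) := fun k => by
    simpa using tendsto_one_div_add_atTop_nhds_zero_nat.const_mul k
  refine ⟨hu, φ, hφ, ?_, fun S hS0 hS => ?_⟩
  · refine (tendsto_wnorm_iff hp hω (f := fun n => deriv (φ n) - u') fun n =>
      (wMem_deriv hω (hφ n).1 (hφ n).2.1 (hφ n).2.2).sub hu').1 ?_
    have h1 := ENNReal.tendsto_ofReal (hlim K)
    rw [ENNReal.ofReal_zero] at h1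
    exact tendsto_of_tendsto_of_tendsto_of_le_of_le tendsto_const_nhds h1 (fun _ => zero_le) hφw
  · obtain ⟨c, d, hc, hcd⟩ := exists_subset_Icc_of_isCompact hS hS0
    rw [Metric.tendstoUniformlyOn_iff]
    intro ε hε
    have e1 := (hlim 1).eventually_lt_const hc
    have e2 := (hlim 4).eventually_lt_const hε
    filter_upwards [e1, e2, eventually_ge_atTop ⌈d⌉₊] with n h1 h2 h3 t ht
    rw [dist_comm, Real.dist_eq]
    refine (hφt n t ⟨?_, ?_⟩).trans_lt h2
    · linarith [(hcd ht).1]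
    · linarith [(hcd ht).2, Nat.le_of_ceil_le h3]

lemma WMem.indicator {f : ℝ → ℝ} (hf : WMem p ω f) {S : Set ℝ} (hS : MeasurableSet S) :
    WMem p ω (S.indicator f) := by
  have : weightedFun p ω (S.indicator f) = S.indicator (weightedFun p ω f) := by
    funext t; by_cases ht : t ∈ S <;> simp [weightedFun, ht]
  rw [WMem, this]; exact MemLp.indicator hS hf

lemma exists_wnorm_indicator_sub_le (hp : 1 < p) (hω : IsWeight ω) {u u' : ℝ → ℝ}
    (hu : MemD p ω u u') {ε : ℝ} (hε : 0 < ε) :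
    ∃ A B : ℝ, 0 < A ∧ ∀ a b, a ≤ A → B ≤ b →
      wnorm p ω ((Ioc a b).indicator u' - u') ≤ ENNReal.ofReal ε := by
  have hp0 : p ≠ 0 := by linarith
  have hu' := hu.wMem hp hω
  set f : ℕ → ℝ → ℝ := fun n => (Ioc (1 / ((n : ℝ) + 1)) n).indicator u' - u' with hf
  have hfW : ∀ n, WMem p ω (f n) := fun n => (hu'.indicator measurableSet_Ioc).sub hu'
  have hlim : Tendsto (fun n => ∫ t in Ioi 0, |f n t| ^ p * ω t) atTop (𝓝 0) := by
    suffices h0 : Tendsto (fun n => ∫ t in Ioi 0, |f n t| ^ p * ω t) atTop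
        (𝓝 (∫ _ in Ioi (0 : ℝ), (0 : ℝ))) by rwa [integral_zero] at h0
    refine tendsto_integral_of_dominated_convergence (fun t => |u' t| ^ p * ω t) (fun n => ?_)
      hu.2.2 (fun n => ?_) ?_
    · exact (((hfW n).aestronglyMeasurable hω).aemeasurable.abs.pow_const p).aestronglyMeasurable.mul
        (hω.1.aestronglyMeasurable measurableSet_Ioi)
    · filter_upwards [ae_restrict_mem measurableSet_Ioi] with t ht
      have hw := hω.2 t ht
      rw [Real.norm_of_nonneg (by positivity)]
      refine mul_le_mul_of_nonneg_right (Real.rpow_le_rpow (abs_nonneg _) ?_ (by linarith)) hw.le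
      by_cases h : t ∈ Ioc (1 / ((n : ℝ) + 1)) (n : ℝ)
      · simp only [hf, Pi.sub_apply, indicator_of_mem h, sub_self, abs_zero, abs_nonneg]
      · simp only [hf, Pi.sub_apply, indicator_of_notMem h, zero_sub, abs_neg, le_refl]
    · filter_upwards [ae_restrict_mem measurableSet_Ioi] with t ht
      refine tendsto_const_nhds.congr' ?_
      filter_upwards [tendsto_one_div_add_atTop_nhds_zero_nat.eventually_lt_const
        (show (0 : ℝ) < t from ht), eventually_ge_atTop ⌈t⌉₊] with n h1 h2
      have h : t ∈ Ioc (1 / ((n : ℝ) + 1)) (n : ℝ) := ⟨h1, Nat.le_of_ceil_le h2⟩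
      simp only [hf, Pi.sub_apply, indicator_of_mem h, sub_self, abs_zero, Real.zero_rpow hp0,
        zero_mul]
  obtain ⟨n, hn⟩ := (((tendsto_wnorm_iff hp hω hfW).2 hlim).eventually_lt_const
    (ENNReal.ofReal_pos.2 hε)).exists
  refine ⟨1 / ((n : ℝ) + 1), n, by positivity, fun a b ha hb => le_trans ?_ hn.le⟩
  refine eLpNorm_mono fun t => ?_
  rw [weightedFun, weightedFun, norm_mul, norm_mul]
  gcongr
  by_cases h : t ∈ Ioc (1 / ((n : ℝ) + 1)) (n : ℝ)
  · have h' : t ∈ Ioc a b := ⟨ha.trans_lt h.1, h.2.trans hb⟩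
    simp [h']
  · rw [hf]
    simp only [Pi.sub_apply, indicator_of_notMem h, zero_sub, norm_neg]
    by_cases h' : t ∈ Ioc a b <;> simp [h']

/-- A function of the Dirichlet space belongs to `D_0^{1,p}` as soon as its boundary values near
`0` and `∞` can be produced at arbitrarily small cost. -/
lemma memD0_of_corrections (hp : 1 < p) (hω : IsWeight ω) {u u' : ℝ → ℝ} (hu : MemD p ω u u')
    (hL : ∀ ε A : ℝ, 0 < ε → 0 < A → ∃ (a c : ℝ) (h : ℝ → ℝ), 0 < c ∧ c ≤ a ∧ a ≤ A ∧
      (∀ t, t ∉ Ioc c a → h t = 0) ∧ WMem p ω h ∧ wnorm p ω h ≤ ENNReal.ofReal ε ∧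
      |(∫ t, h t) - u a| ≤ ε)
    (hR : ∀ ε B : ℝ, 0 < ε → 0 < B → ∃ (b d : ℝ) (h : ℝ → ℝ), B ≤ b ∧ b ≤ d ∧
      (∀ t, t ∉ Ioc b d → h t = 0) ∧ WMem p ω h ∧ wnorm p ω h ≤ ENNReal.ofReal ε ∧
      |(∫ t, h t) - u b| ≤ ε) :
    MemD0 p ω u u' := by
  have hu' := hu.wMem hp hω
  refine memD0_of_approximation hp hω hu fun ε a₀ b₀ hε ha₀ hab₀ => ?_
  have hε3 : 0 < ε / 3 := by positivity
  obtain ⟨A, B, hA, hAB⟩ := exists_wnorm_indicator_sub_le hp hω hu hε3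
  obtain ⟨a, c, h₁, hc, hca, haA, h₁0, h₁W, h₁n, h₁i⟩ := hL _ _ hε3 (lt_min hA ha₀)
  obtain ⟨b, d, h₂, hbB, hbd, h₂0, h₂W, h₂n, h₂i⟩ :=
    hR _ (max B b₀) hε3 (lt_max_of_lt_right (ha₀.trans hab₀))
  have ha := haA.trans (min_le_right _ _)
  have hb := (le_max_right _ _).trans hbB
  have hcd : c < d := by linarith
  have h₁0' : ∀ t, t ∉ Icc c d → h₁ t = 0 := fun t ht =>
    h₁0 t fun h => ht ⟨h.1.le, by linarith [h.2]⟩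
  have h₂0' : ∀ t, t ∉ Icc c d → h₂ t = 0 := fun t ht =>
    h₂0 t fun h => ht ⟨by linarith [h.1], h.2⟩
  have hm0' : ∀ t, t ∉ Icc c d → (Ioc a b).indicator u' t = 0 := fun t ht =>
    indicator_of_notMem (fun h => ht ⟨by linarith [h.1], by linarith [h.2]⟩) _
  have hmW : WMem p ω ((Ioc a b).indicator u') := hu'.indicator measurableSet_Ioc
  have h₁I := h₁W.integrable hp hω hc h₁0'
  have h₂I := h₂W.integrable hp hω hc h₂0'
  have hmI := hmW.integrable hp hω hc hm0'
  have hincr : ∀ t, a ≤ t → ∫ s in Ioc a t, u' s = u t - u a := fun t hat => by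
    rcases hat.eq_or_lt with rfl | hat
    · simp
    · rw [hu.2.1 a t (hc.trans_le hca) hat, intervalIntegral.integral_of_le hat.le]
  refine ⟨h₁ + (Ioc a b).indicator u' - h₂, c, d, hc, hcd, fun t ht => ?_,
    (h₁W.add hmW).sub h₂W, ?_, ?_, fun t ht => ?_⟩
  · simp only [Pi.sub_apply, Pi.add_apply, h₁0' t ht, h₂0' t ht, hm0' t ht]; simp
  · have : h₁ + (Ioc a b).indicator u' - h₂ - u' =
        h₁ + ((Ioc a b).indicator u' - u') - h₂ := by abel
    rw [this]
    calc _ ≤ wnorm p ω h₁ + wnorm p ω ((Ioc a b).indicator u' - u') + wnorm p ω h₂ := by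
          refine (wnorm_sub_le hp (h₁W.add (hmW.sub hu')) h₂W).trans ?_
          gcongr
          exact wnorm_add_le hp h₁W (hmW.sub hu')
      _ ≤ ENNReal.ofReal (ε / 3) + ENNReal.ofReal (ε / 3) + ENNReal.ofReal (ε / 3) := by
          gcongr
          exact hAB a b (haA.trans (min_le_left _ _)) ((le_max_left _ _).trans hbB)
      _ = ENNReal.ofReal ε := by
          rw [← ENNReal.ofReal_add hε3.le hε3.le, ← ENNReal.ofReal_add (by positivity) hε3.le]
          congr 1; ring
  · have : ∫ t, (h₁ + (Ioc a b).indicator u' - h₂) t =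
        (∫ t, h₁ t) + (u b - u a) - ∫ t, h₂ t := by
      rw [integral_sub' (h₁I.add hmI) h₂I, integral_add' h₁I hmI,
        integral_indicator measurableSet_Ioc, hincr b (by linarith)]
    rw [this]
    rw [abs_le] at h₁i h₂i ⊢
    constructor <;> linarith [h₁i.1, h₁i.2, h₂i.1, h₂i.2]
  · have hat : a ≤ t := ha.trans ht.1
    have e1 : ∫ s in Ioc 0 t, h₁ s = ∫ s, h₁ s :=
      setIntegral_eq_integral_of_forall_compl_eq_zero fun s hs =>
        h₁0 s fun h => hs ⟨hc.trans h.1, h.2.trans hat⟩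
    have e2 : ∫ s in Ioc 0 t, h₂ s = 0 :=
      setIntegral_eq_zero_of_forall_eq_zero fun s hs =>
        h₂0 s fun h => by linarith [h.1, hs.2, ht.2]
    have e3 : ∫ s in Ioc 0 t, (Ioc a b).indicator u' s = u t - u a := by
      rw [setIntegral_indicator measurableSet_Ioc, ← hincr t hat, Ioc_inter_Ioc,
        sup_eq_right.2 (hc.trans_le hca).le, inf_eq_left.2 (ht.2.trans hb)]
    have : ∫ s in Ioc 0 t, (h₁ + (Ioc a b).indicator u' - h₂) s =
        (∫ t, h₁ t) + (u t - u a) := by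
      rw [integral_sub' (h₁I.add hmI).integrableOn h₂I.integrableOn,
        integral_add' h₁I.integrableOn hmI.integrableOn, e1, e2, e3, sub_zero]
    rw [this]
    have : (∫ t, h₁ t) + (u t - u a) - u t = (∫ t, h₁ t) - u a := by ring
    rw [this]
    linarith

/-- If the dual weight has large mass on an interval, that interval carries a function of
integral `1` and small weighted norm. -/
lemma exists_unit_mass (hp : 1 < p) (hω : IsWeight ω) {ε : ℝ} (hε : 0 < ε) :
    ∃ M : ℝ, ∀ c d : ℝ, 0 < c → M < ∫ t in Ioc c d, ω t ^ (-1 / (p - 1)) →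
      ∃ h : ℝ → ℝ, (∀ t, t ∉ Ioc c d → h t = 0) ∧ WMem p ω h ∧
        wnorm p ω h ≤ ENNReal.ofReal ε ∧ ∫ t, h t = 1 := by
  have hp1 : 0 < p - 1 := by linarith
  have hp0 : 0 < p := by linarith
  have hlim : Tendsto (fun S : ℝ => S ^ (-((p - 1) / p))) atTop (𝓝 0) :=
    tendsto_rpow_neg_atTop (by positivity)
  obtain ⟨M, hM⟩ := eventually_atTop.1 (hlim.eventually_lt_const hε)
  refine ⟨max M 0, fun c d hc hS => ?_⟩
  set σ : ℝ → ℝ := fun t => ω t ^ (-1 / (p - 1)) with hσ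
  set S := ∫ t in Ioc c d, σ t with hSdef
  have hS0 : 0 < S := (le_max_right _ _).trans_lt hS
  have hsub : Ioc c d ⊆ Ioi 0 := fun t ht => hc.trans ht.1
  have hσi : IntegrableOn σ (Ioc c d) := (hω.integrableOn_Icc _ hc).mono_set Ioc_subset_Icc_self
  have hpow : ∀ t, |(Ioc c d).indicator (fun t => S⁻¹ * σ t) t| ^ p * ω t =
      (Ioc c d).indicator (fun t => S ^ (-p) * σ t) t := fun t => by
    by_cases ht : t ∈ Ioc c d
    · have hw := hω.2 t (hsub ht)
      have hσt : 0 < σ t := Real.rpow_pos_of_pos hw _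
      rw [indicator_of_mem ht, indicator_of_mem ht, abs_of_pos (by positivity),
        Real.mul_rpow (by positivity) hσt.le, Real.inv_rpow hS0.le, ← Real.rpow_neg hS0.le,
        mul_assoc]
      congr 1
      simp only [hσ]
      rw [← Real.rpow_mul hw.le]
      nth_rewrite 2 [← Real.rpow_one (ω t)]
      rw [← Real.rpow_add hw]
      congr 1
      field_simp
      ring
    · rw [indicator_of_notMem ht, indicator_of_notMem ht, abs_zero, Real.zero_rpow hp0.ne',
        zero_mul]
  have hind : Integrable ((Ioc c d).indicator fun t => S⁻¹ * σ t) :=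
    (integrable_indicator_iff measurableSet_Ioc).2 (hσi.const_mul _)
  have hW : WMem p ω ((Ioc c d).indicator fun t => S⁻¹ * σ t) := by
    refine wMem_of_integrableOn hp hω hind.aestronglyMeasurable.restrict ?_
    simp only [hpow]
    exact ((integrable_indicator_iff measurableSet_Ioc).2 (hσi.const_mul _)).integrableOn
  refine ⟨_, fun t ht => indicator_of_notMem ht _, hW, ?_, ?_⟩
  · rw [wnorm_eq hp hω hW]
    apply ENNReal.ofReal_le_ofReal
    simp only [hpow]
    rw [setIntegral_indicator measurableSet_Ioc, inter_eq_right.2 hsub, integral_const_mul,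
      ← hSdef]
    nth_rewrite 2 [← Real.rpow_one S]
    rw [← Real.rpow_add hS0, ← Real.rpow_mul hS0.le]
    have : (-p + 1) * (1 / p) = -((p - 1) / p) := by field_simp; ring
    rw [this]
    exact (hM S ((le_max_left _ _).trans hS.le)).le
  · rw [integral_indicator measurableSet_Ioc, integral_const_mul, ← hSdef]
    field_simp

lemma exists_mass (hp : 1 < p) (hω : IsWeight ω) {ε : ℝ} (hε : 0 < ε) (k : ℝ) :
    ∃ M : ℝ, ∀ c d : ℝ, 0 < c → M < ∫ t in Ioc c d, ω t ^ (-1 / (p - 1)) →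
      ∃ h : ℝ → ℝ, (∀ t, t ∉ Ioc c d → h t = 0) ∧ WMem p ω h ∧
        wnorm p ω h ≤ ENNReal.ofReal ε ∧ ∫ t, h t = k := by
  obtain ⟨M, hM⟩ := exists_unit_mass hp hω (show 0 < ε / (|k| + 1) by positivity)
  refine ⟨M, fun c d hc hS => ?_⟩
  obtain ⟨h, h0, hW, hn, hi⟩ := hM c d hc hS
  refine ⟨k • h, fun t ht => by simp [h0 t ht], hW.smul k, ?_, by
    simp [integral_const_mul, hi]⟩
  rw [wnorm_smul]
  calc _ ≤ ENNReal.ofReal |k| * ENNReal.ofReal (ε / (|k| + 1)) := by gcongr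
    _ = ENNReal.ofReal (|k| * (ε / (|k| + 1))) := (ENNReal.ofReal_mul (abs_nonneg _)).symm
    _ ≤ ENNReal.ofReal ε := by
      apply ENNReal.ofReal_le_ofReal
      rw [mul_div_assoc', div_le_iff₀ (by positivity)]
      nlinarith [abs_nonneg k]


lemma Bp0.integrableOn_Ioc (hω : IsWeight ω) (h : Bp0 p ω) (t : ℝ) :
    IntegrableOn (fun s => ω s ^ (-1 / (p - 1))) (Ioc 0 t) :=
  (IntegrableOn.union h (hω.integrableOn_Icc _ one_pos (d := t))).mono_set fun s hs =>
    (le_total s 1).imp (fun h1 => ⟨hs.1, h1⟩) fun h1 => ⟨h1, hs.2⟩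

lemma BpInf.integrableOn_Ioi (hω : IsWeight ω) (h : BpInf p ω) {t : ℝ} (ht : 0 < t) :
    IntegrableOn (fun s => ω s ^ (-1 / (p - 1))) (Ioi t) :=
  ((hω.integrableOn_Icc _ ht (d := 1)).union h).mono_set fun s hs =>
    (le_or_gt s 1).imp (fun h1 => ⟨le_of_lt hs, h1⟩) fun h1 => h1

lemma exists_lt_integral_of_not_bp0 (hω : IsWeight ω) (h : ¬ Bp0 p ω) (M : ℝ) {A : ℝ}
    (hA : 0 < A) :
    ∃ c, 0 < c ∧ c ≤ A ∧ M < ∫ t in Ioc c A, ω t ^ (-1 / (p - 1)) := by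
  by_contra! hb
  set σ : ℝ → ℝ := fun t => ω t ^ (-1 / (p - 1))
  have hσ0 : ∀ t, 0 < t → 0 < σ t := fun t ht => Real.rpow_pos_of_pos (hω.2 t ht) _
  have hpos : ∀ n : ℕ, 0 < A / ((n : ℝ) + 1) := fun n => by positivity
  have hle : ∀ n : ℕ, A / ((n : ℝ) + 1) ≤ A := fun n =>
    div_le_self hA.le (by linarith [n.cast_nonneg (α := ℝ)])
  have hlim : Tendsto (fun n : ℕ => A / ((n : ℝ) + 1)) atTop (𝓝 0) := by
    simpa [div_eq_mul_inv] using tendsto_one_div_add_atTop_nhds_zero_nat.const_mul A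
  have hint : IntegrableOn σ (Ioc 0 A) := by
    refine integrableOn_Ioc_of_intervalIntegral_norm_bounded_left (I := M)
      (fun n => (hω.integrableOn_Icc _ (hpos n)).mono_set Ioc_subset_Icc_self) hlim
      (Eventually.of_forall fun n => ?_)
    rw [setIntegral_congr_fun measurableSet_Ioc fun t ht =>
      Real.norm_of_nonneg (hσ0 t ((hpos n).trans ht.1)).le]
    exact hb _ (hpos n) (hle n)
  exact h ((hint.union (hω.integrableOn_Icc _ hA (d := 1))).mono_set fun s hs =>
    (le_total s A).imp (fun h1 => ⟨hs.1, h1⟩) fun h1 => ⟨h1, hs.2⟩)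

lemma exists_lt_integral_of_not_bpInf (hω : IsWeight ω) (h : ¬ BpInf p ω) (M : ℝ) {B : ℝ}
    (hB : 0 < B) :
    ∃ d, B ≤ d ∧ M < ∫ t in Ioc B d, ω t ^ (-1 / (p - 1)) := by
  by_contra! hb
  set σ : ℝ → ℝ := fun t => ω t ^ (-1 / (p - 1))
  have hσ0 : ∀ t, 0 < t → 0 < σ t := fun t ht => Real.rpow_pos_of_pos (hω.2 t ht) _
  have hint : IntegrableOn σ (Ioi B) := by
    refine integrableOn_Ioi_of_intervalIntegral_norm_bounded (l := atTop) M B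
      (fun d : ℝ => (hω.integrableOn_Icc _ hB (d := d)).mono_set Ioc_subset_Icc_self) tendsto_id ?_
    filter_upwards [eventually_ge_atTop B] with d hd
    rw [intervalIntegral.integral_of_le hd, setIntegral_congr_fun measurableSet_Ioc fun t ht =>
      Real.norm_of_nonneg (hσ0 t (hB.trans ht.1)).le]
    exact hb _ hd
  exact h (((hω.integrableOn_Icc _ one_pos (d := B)).union hint).mono_set fun s hs =>
    (le_or_gt s B).imp (fun h1 => ⟨le_of_lt hs, h1⟩) fun h1 => h1)

lemma exists_correction_zero_of_not_bp0 (hp : 1 < p) (hω : IsWeight ω) (h0 : ¬ Bp0 p ω)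
    (u : ℝ → ℝ) (ε A : ℝ) (hε : 0 < ε) (hA : 0 < A) :
    ∃ (a c : ℝ) (h : ℝ → ℝ), 0 < c ∧ c ≤ a ∧ a ≤ A ∧
      (∀ t, t ∉ Ioc c a → h t = 0) ∧ WMem p ω h ∧ wnorm p ω h ≤ ENNReal.ofReal ε ∧
      |(∫ t, h t) - u a| ≤ ε := by
  obtain ⟨M, hM⟩ := exists_mass hp hω hε (u A)
  obtain ⟨c, hc, hcA, hS⟩ := exists_lt_integral_of_not_bp0 hω h0 M hA
  obtain ⟨h, hs, hW, hn, hi⟩ := hM c A hc hS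
  exact ⟨A, c, h, hc, hcA, le_rfl, hs, hW, hn, by simp [hi, hε.le]⟩

lemma exists_correction_infty_of_not_bpInf (hp : 1 < p) (hω : IsWeight ω) (h0 : ¬ BpInf p ω)
    (u : ℝ → ℝ) (ε B : ℝ) (hε : 0 < ε) (hB : 0 < B) :
    ∃ (b d : ℝ) (h : ℝ → ℝ), B ≤ b ∧ b ≤ d ∧
      (∀ t, t ∉ Ioc b d → h t = 0) ∧ WMem p ω h ∧ wnorm p ω h ≤ ENNReal.ofReal ε ∧
      |(∫ t, h t) - u b| ≤ ε := by
  obtain ⟨M, hM⟩ := exists_mass hp hω hε (u B)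
  obtain ⟨d, hd, hS⟩ := exists_lt_integral_of_not_bpInf hω h0 M hB
  obtain ⟨h, hs, hW, hn, hi⟩ := hM B d hB hS
  exact ⟨B, d, h, le_rfl, hd, hs, hW, hn, by simp [hi, hε.le]⟩

lemma MemR0.tendsto_zero {u u' : ℝ → ℝ} (h : MemR0 p ω 0 u u') :
    Tendsto u (𝓝[>] 0) (𝓝 0) := by
  have h1 : IntegrableOn u' (Icc 0 1) :=
    (integrableOn_Icc_iff_integrableOn_Ioc (by simp)).2 (h.2 1 one_pos).1
  have h2 := (intervalIntegral.continuousOn_primitive_Icc h1 0 (by simp)).tendsto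
  have h3 : 𝓝[>] (0 : ℝ) ≤ 𝓝[Icc 0 1] 0 := by
    rw [nhdsWithin_le_iff]
    exact mem_of_superset (Ioc_mem_nhdsGT one_pos) Ioc_subset_Icc_self
  have h4 := h2.mono_left h3
  rw [Icc_self, Measure.restrict_eq_zero.2 (by simp), integral_zero_measure] at h4
  refine h4.congr' ?_
  filter_upwards [self_mem_nhdsWithin] with t ht
  rw [(h.2 t ht).2, integral_Icc_eq_integral_Ioc, zero_add]

lemma MemR0.exists_correction {u u' : ℝ → ℝ} (h : MemR0 p ω 0 u u') (ε A : ℝ) (hε : 0 < ε)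
    (hA : 0 < A) :
    ∃ (a c : ℝ) (h : ℝ → ℝ), 0 < c ∧ c ≤ a ∧ a ≤ A ∧
      (∀ t, t ∉ Ioc c a → h t = 0) ∧ WMem p ω h ∧ wnorm p ω h ≤ ENNReal.ofReal ε ∧
      |(∫ t, h t) - u a| ≤ ε := by
  have h1 := (h.tendsto_zero.abs.eventually_lt_const (by simpa using hε)).and
    (Ioc_mem_nhdsGT hA)
  obtain ⟨a, ha, ha'⟩ := h1.exists
  exact ⟨a, a, 0, ha'.1, le_rfl, ha'.2, fun _ _ => rfl, wMem_zero, by simp [wnorm_zero],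
    by simpa using ha.le⟩

lemma MemD0.exists_tendsto (hp : 1 < p) (hω : IsWeight ω) {u u' : ℝ → ℝ} (h : MemD0 p ω u u') :
    ∃ φ : ℕ → ℝ → ℝ,
      (∀ n, ContDiff ℝ (⊤ : ℕ∞) (φ n) ∧ HasCompactSupport (φ n) ∧ tsupport (φ n) ⊆ Ioi 0) ∧
      (∀ t, 0 < t → Tendsto (fun n => φ n t) atTop (𝓝 (u t))) ∧
      ∀ E : Set ℝ, MeasurableSet E → E ⊆ Ioi 0 →
        IntegrableOn (fun t => ω t ^ (-1 / (p - 1))) E →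
        Tendsto (fun n => ∫ t in E, deriv (φ n) t) atTop (𝓝 (∫ t in E, u' t)) := by
  obtain ⟨hu, φ, hφ, hφd, hφu⟩ := h
  have hW : ∀ n, WMem p ω (deriv (φ n)) := fun n =>
    wMem_deriv hω (hφ n).1 (hφ n).2.1 (hφ n).2.2
  have hu' := hu.wMem hp hω
  refine ⟨φ, hφ, fun t ht => ?_, fun E hE hE0 hσ => ?_⟩
  · exact (hφu {t} (by simpa using ht) isCompact_singleton).tendsto_at rfl
  · exact tendsto_setIntegral_of_wnorm hp hω hE hE0 hσ hW hu'
      ((tendsto_wnorm_iff hp hω fun n => (hW n).sub hu').2 hφd)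

lemma MemD0.memR0 (hp : 1 < p) (hω : IsWeight ω) (h0 : Bp0 p ω) {u u' : ℝ → ℝ}
    (h : MemD0 p ω u u') : MemR0 p ω 0 u u' := by
  obtain ⟨φ, hφ, hφu, hφE⟩ := h.exists_tendsto hp hω
  refine ⟨h.1, fun t ht => ?_⟩
  have hsub : Ioc 0 t ⊆ Ioi 0 := Ioc_subset_Ioi_self
  have hσ := h0.integrableOn_Ioc hω t
  refine ⟨(h.1.wMem hp hω).integrableOn hp hω measurableSet_Ioc hsub hσ, ?_⟩
  rw [zero_add]
  refine tendsto_nhds_unique ((hφu t ht).congr fun n => ?_) (hφE _ measurableSet_Ioc hsub hσ)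
  have h00 : φ n 0 = 0 := image_eq_zero_of_notMem_tsupport fun h' =>
    lt_irrefl (0 : ℝ) ((hφ n).2.2 h')
  rw [← intervalIntegral.integral_of_le ht.le, intervalIntegral.integral_deriv_eq_sub, h00,
    sub_zero]
  · exact fun x _ => (hφ n).1.differentiable (by simp) x
  · exact ((hφ n).1.continuous_deriv (by simp)).intervalIntegrable _ _

lemma MemD0.eq_neg_integral_Ioi (hp : 1 < p) (hω : IsWeight ω) (h0 : BpInf p ω) {u u' : ℝ → ℝ}
    (h : MemD0 p ω u u') {t : ℝ} (ht : 0 < t) : u t = -∫ s in Ioi t, u' s := by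
  obtain ⟨φ, hφ, hφu, hφE⟩ := h.exists_tendsto hp hω
  refine tendsto_nhds_unique (hφu t ht) (((hφE _ measurableSet_Ioi (Ioi_subset_Ioi ht.le)
    (h0.integrableOn_Ioi hω ht)).neg).congr fun n => ?_)
  rw [HasCompactSupport.integral_Ioi_deriv_eq ((hφ n).1.of_le (by simp)) (hφ n).2.1, neg_neg]

/-- A smooth step from `0` on `(-∞, 1]` to `1` on `[2, ∞)`, with its derivative. -/
lemma exists_memD_step (hp : 1 < p) (hω : IsWeight ω) :
    ∃ v v' : ℝ → ℝ, MemD p ω v v' ∧ (∀ t, v t = ∫ s in Ioc 0 t, v' s) ∧ Integrable v' ∧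
      (∀ t, t ≤ 1 → v t = 0) ∧ (∀ t, 2 ≤ t → v t = 1) ∧ ∀ t, 2 < t → v' t = 0 := by
  let B : ContDiffBump (3 / 2 : ℝ) := ⟨1 / 4, 1 / 2, by norm_num, by norm_num⟩
  set η : ℝ → ℝ := B.normed volume with hη
  have hηc : Continuous η := (B.contDiff_normed (n := 0)).continuous
  have hη1 : ∫ t, η t = 1 := B.integral_normed
  have hηsupp : Function.support η ⊆ Ioo 1 2 := by
    rw [hη, B.support_normed_eq, Real.ball_eq_Ioo]
    apply Ioo_subset_Ioo <;> norm_num [B]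
  have hη0 : ∀ t, t ∉ Ioo (1 : ℝ) 2 → η t = 0 := fun t ht =>
    Function.notMem_support.1 fun h' => ht (hηsupp h')
  have hηI : Integrable η := hηc.integrable_of_hasCompactSupport B.hasCompactSupport_normed
  have hp0 : p ≠ 0 := by linarith
  refine ⟨fun t => ∫ s in Ioc 0 t, η s, η, ⟨fun a b _ _ => hηI.integrableOn,
    fun a b ha hab => ?_, ?_⟩, fun t => rfl, hηI, fun t ht => ?_, fun t ht => ?_, fun t ht => ?_⟩
  · simp only
    rw [← intervalIntegral.integral_of_le ha.le, ← intervalIntegral.integral_of_le (ha.trans hab).le,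
      intervalIntegral.integral_interval_sub_left] <;> exact hηI.intervalIntegrable
  · have hc : ContinuousOn (fun t => |η t| ^ p * ω t) (Icc 1 2) :=
      ((hηc.abs.rpow_const fun _ => Or.inr (by linarith)).continuousOn).mul
        (hω.1.mono fun t ht => one_pos.trans_le ht.1)
    refine (hc.integrableOn_Icc.integrable_of_forall_notMem_eq_zero fun t ht => ?_).integrableOn
    rw [hη0 t fun h => ht (Ioo_subset_Icc_self h), abs_zero, Real.zero_rpow hp0, zero_mul]
  · exact setIntegral_eq_zero_of_forall_eq_zero fun s hs =>
      hη0 s fun h => absurd (hs.2.trans ht) (not_le.2 h.1)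
  · simp only
    rw [← hη1]
    exact setIntegral_eq_integral_of_forall_compl_eq_zero fun s hs =>
      hη0 s fun h => hs ⟨one_pos.trans h.1, h.2.le.trans ht⟩
  · exact hη0 t fun h => lt_asymm ht h.2

lemma memD_one_sub {v v' : ℝ → ℝ} (h : MemD p ω v v') :
    MemD p ω (fun t => 1 - v t) (fun t => -v' t) := by
  refine ⟨fun a b ha hab => (h.1 a b ha hab).neg, fun a b ha hab => ?_, ?_⟩
  · rw [intervalIntegral.integral_neg, ← h.2.1 a b ha hab]; ring
  · simpa only [abs_neg] using h.2.2

lemma memD_const (hp : 1 < p) (k : ℝ) : MemD p ω (fun _ => k) 0 := by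
  have hp0 : p ≠ 0 := by linarith
  refine ⟨fun a b _ _ => integrableOn_zero, fun a b _ _ => by simp, ?_⟩
  simp [Real.zero_rpow hp0]

end WeightedSpace

/-- `D_0^{1,p}(ℝ₊,ω) = R^0_{p,ω}(0)` iff
`ω ∈ B_p(0) ∖ B_p(∞)`, and `D_0^{1,p}(ℝ₊,ω) = D^{1,p}(ℝ₊,ω)` iff
`ω ∉ B_p(0) ∪ B_p(∞)`. -/
theorem stmt17 (p : ℝ) (ω : ℝ → ℝ) (hp : 1 < p) (hω : IsWeight ω) :
    ((∀ u u' : ℝ → ℝ, MemD p ω u u' → (MemD0 p ω u u' ↔ MemR0 p ω 0 u u')) ↔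
      (Bp0 p ω ∧ ¬ BpInf p ω)) ∧
    ((∀ u u' : ℝ → ℝ, MemD p ω u u' → MemD0 p ω u u') ↔
      (¬ Bp0 p ω ∧ ¬ BpInf p ω)) := by
  obtain ⟨v, v', hv, hvi, hvI, hv0, hv1, hv2⟩ := exists_memD_step hp hω
  have hc : MemD p ω (fun _ => 1) 0 := memD_const hp 1
  refine ⟨⟨fun H => ?_, fun ⟨h0, hI⟩ u u' hu => ⟨fun h => h.memR0 hp hω h0, fun h =>
    memD0_of_corrections hp hω hu h.exists_correction
      (exists_correction_infty_of_not_bpInf hp hω hI u)⟩⟩,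
    ⟨fun H => ⟨fun h0 => ?_, fun hI => ?_⟩, fun ⟨h0, hI⟩ u u' hu =>
      memD0_of_corrections hp hω hu (exists_correction_zero_of_not_bp0 hp hω h0 u)
        (exists_correction_infty_of_not_bpInf hp hω hI u)⟩⟩
  · have h0 : Bp0 p ω := by
      by_contra h0
      have hu := memD_one_sub hv
      have hu0 : MemD0 p ω (fun t => 1 - v t) fun t => -v' t :=
        memD0_of_corrections hp hω hu (exists_correction_zero_of_not_bp0 hp hω h0 _)
          fun ε B hε hB => ⟨max B 2, max B 2, 0, le_max_left _ _, le_rfl, fun _ _ => rfl,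
            wMem_zero, by simp [wnorm_zero], by simp [hv1 _ (le_max_right B 2), hε.le]⟩
      have h1 := (((H _ _ hu).1 hu0).2 1 one_pos).2
      rw [integral_neg, ← hvi, hv0 1 le_rfl] at h1
      simp only [hv0 1 le_rfl] at h1
      norm_num at h1
    refine ⟨h0, fun hI => ?_⟩
    have hR : MemR0 p ω 0 v v' :=
      ⟨hv, fun t _ => ⟨hvI.integrableOn, by rw [zero_add]; exact hvi t⟩⟩
    have h1 := ((H _ _ hv).2 hR).eq_neg_integral_Ioi hp hω hI two_pos
    rw [hv1 2 le_rfl, setIntegral_eq_zero_of_forall_eq_zero (t := Ioi 2) hv2] at h1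
    norm_num at h1
  · have h1 := (((H _ _ hc).memR0 hp hω h0).2 1 one_pos).2
    simp at h1
  · have h1 := (H _ _ hc).eq_neg_integral_Ioi hp hω hI one_pos
    simp at h1

end
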